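/- Consider the two-player 'imitation' game where each player chooses an action in $\{0, 1/k, \dots, 1\}$, player 1 receives utility $-|a-b|^2$ and player 2 receives utility $-|c - b|^2$ for a fixed target $c \in \{0, 1/k, \dots, 1\}$, where $a$ is player 1's action and $b$ is player 2's action. Then in every $\frac{3}{4k^2}$-well-supported Nash equilibrium, player 2 plays $c$ with probability 1, and player 1's support is contained in $\{c\}$. -/

import Mathlib

/-- in the two-player imitation game on the grid `{0, 1/k, …, 1}`
(player 1 plays `a` with utility `-(a - b)²`, player 2 plays `b` with utility `-(c - b)²`
for a fixed target `c`), in every `3/(4k²)`-well-supported Nash equilibrium player 2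
plays `c` with probability 1 and player 1's support is `{c}`.
Actions `j : Fin (k+1)` correspond to the real value `j/k`. -/
theorem stmt8 (k : ℕ) (hk : 1 ≤ k) (c : Fin (k + 1))
    (p q : Fin (k + 1) → ℝ)
    (hp0 : ∀ a, 0 ≤ p a) (hp1 : ∑ a, p a = 1)
    (hq0 : ∀ b, 0 ≤ q b) (hq1 : ∑ b, q b = 1)
    (hWSNE1 : ∀ a : Fin (k + 1), 0 < p a → ∀ a' : Fin (k + 1),
      (∑ b, q b * (-(((a : ℝ) / k) - ((b : ℝ) / k)) ^ 2)) ≥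
        (∑ b, q b * (-(((a' : ℝ) / k) - ((b : ℝ) / k)) ^ 2)) - 3 / (4 * (k : ℝ) ^ 2))
    (hWSNE2 : ∀ b : Fin (k + 1), 0 < q b → ∀ b' : Fin (k + 1),
      (-(((c : ℝ) / k) - ((b : ℝ) / k)) ^ 2) ≥
        (-(((c : ℝ) / k) - ((b' : ℝ) / k)) ^ 2) - 3 / (4 * (k : ℝ) ^ 2)) :
    q c = 1 ∧ (∀ a, 0 < p a → a = c) := by
  have hk0 : (0 : ℝ) < k := by exact_mod_cast hk
  have key : ∀ a : Fin (k + 1),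
      (-(((c : ℝ) / k) - ((a : ℝ) / k)) ^ 2) ≥
        (-(((c : ℝ) / k) - ((c : ℝ) / k)) ^ 2) - 3 / (4 * (k : ℝ) ^ 2) → a = c := by
    intro a h
    by_contra hne
    have hz : ((c : ℕ) : ℤ) - ((a : ℕ) : ℤ) ≠ 0 := by
      intro h0
      apply hne
      apply Fin.ext
      omega
    have h1 : (1 : ℤ) ≤ (((c : ℕ) : ℤ) - ((a : ℕ) : ℤ)) ^ 2 := by
      have := sq_nonneg (((c : ℕ) : ℤ) - ((a : ℕ) : ℤ))
      have := pow_ne_zero 2 hz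
      omega
    have h2 : (1 : ℝ) ≤ ((c : ℝ) - (a : ℝ)) ^ 2 := by exact_mod_cast h1
    have e1 : (((c : ℝ) / k) - ((a : ℝ) / k)) ^ 2 = ((c : ℝ) - (a : ℝ)) ^ 2 / (k : ℝ) ^ 2 := by
      field_simp
    have e2 : 3 / (4 * (k : ℝ) ^ 2) = (3 / 4) / (k : ℝ) ^ 2 := by
      field_simp
    rw [e1, e2] at h
    have h3 : ((c : ℝ) - (a : ℝ)) ^ 2 / (k : ℝ) ^ 2 ≤ (3 / 4) / (k : ℝ) ^ 2 := by
      simp only [sub_self] at h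
      linarith
    rw [div_le_div_iff_of_pos_right (by positivity)] at h3
    linarith
  have hq : ∀ b, b ≠ c → q b = 0 := by
    intro b hb
    by_contra h
    exact hb (key b (hWSNE2 b (lt_of_le_of_ne (hq0 b) (Ne.symm h)) c))
  have hqc : q c = 1 := by
    rw [← hq1]
    exact (Finset.sum_eq_single c (fun b _ hb => hq b hb) (by simp)).symm
  have hs : ∀ f : Fin (k + 1) → ℝ, ∑ b, q b * f b = f c := by
    intro f
    rw [Finset.sum_eq_single c (fun b _ hb => by rw [hq b hb, zero_mul]) (by simp), hqc, one_mul]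
  refine ⟨hqc, fun a ha => key a ?_⟩
  have h := hWSNE1 a ha c
  rw [hs, hs] at h
  rw [sub_sq_comm ((c : ℝ) / k) ((a : ℝ) / k)]
  exact h
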